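/- Let λ = sup_{t∈(0,1)} sup_{α∈ℝ^p, α≠0} ‖Σ^{−1/2}XᵀD(B̂+tα)Xα‖² / ‖Σ^{1/2}α‖². Assume either (a) Q is positive definite, or (b) Q = 0, X has full column rank, and for every β ∈ ℝ^p \ {0} there exists i ∈ {1,…,n} such that either X_iᵀβ·1{Y_i=1} < 0 or X_iᵀβ·1{Y_i=0} > 0 (the condition guaranteeing existence of the posterior mode B̂). Then λ < 1. -/

import Mathlib

open MeasureTheory Matrix Filter

noncomputable section

/-- standard normal pdf -/
def nphi (x : ℝ) : ℝ := (Real.sqrt (2 * Real.pi))⁻¹ * Real.exp (-(x ^ 2) / 2)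

/-- standard normal cdf -/
def nPhi (x : ℝ) : ℝ := ∫ t in Set.Iic x, nphi t

/-- density of TN(θ,1;1) (if b = true) resp. TN(θ,1;0) (if b = false) at z -/
def tn (θ : ℝ) (b : Bool) (z : ℝ) : ℝ :=
  if b then (if 0 < z then nphi (z - θ) / nPhi θ else 0)
  else (if z < 0 then nphi (z - θ) / (1 - nPhi θ) else 0)

/-- p-variate Gaussian density with mean μ and covariance matrix Λ -/
def mvn {p : ℕ} (μ : Fin p → ℝ) (Λ : Matrix (Fin p) (Fin p) ℝ) (x : Fin p → ℝ) : ℝ :=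
  Real.sqrt (((2 * Real.pi) ^ p * Λ.det)⁻¹) *
    Real.exp (-(dotProduct (x - μ) (Λ⁻¹.mulVec (x - μ))) / 2)

/-- squared Euclidean norm -/
def normSq {m : ℕ} (x : Fin m → ℝ) : ℝ := ∑ i, x i ^ 2

/-- Albert and Chib's Markov transition density, with Σ = XᵀX + Q -/
def kAC {n p : ℕ} (X : Matrix (Fin n) (Fin p) ℝ) (Y : Fin n → Bool)
    (v : Fin p → ℝ) (Q : Matrix (Fin p) (Fin p) ℝ) (β β' : Fin p → ℝ) : ℝ :=
  ∫ z : Fin n → ℝ,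
    mvn ((Xᵀ * X + Q)⁻¹.mulVec (Xᵀ.mulVec z + Q.mulVec v)) (Xᵀ * X + Q)⁻¹ β' *
      ∏ i, tn (dotProduct (X i) β) (Y i) (z i)

/-- the defining property of the posterior mode B̂ -/
def IsPosteriorMode {n p : ℕ} (X : Matrix (Fin n) (Fin p) ℝ) (Y : Fin n → Bool)
    (v : Fin p → ℝ) (Q : Matrix (Fin p) (Fin p) ℝ) (Bhat : Fin p → ℝ) : Prop :=
  (∑ i, (if Y i then nphi (dotProduct (X i) Bhat) / nPhi (dotProduct (X i) Bhat)
          else -(nphi (dotProduct (X i) Bhat) / (1 - nPhi (dotProduct (X i) Bhat)))) • X i)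
    - Q.mulVec (Bhat - v) = 0

/-- g(θ) = θφ(θ)/Φ(θ) + (φ(θ)/Φ(θ))² -/
def gfun (θ : ℝ) : ℝ := θ * nphi θ / nPhi θ + (nphi θ / nPhi θ) ^ 2

/-- the diagonal matrix D(β) -/
def Dmat {n p : ℕ} (X : Matrix (Fin n) (Fin p) ℝ) (Y : Fin n → Bool) (β : Fin p → ℝ) :
    Matrix (Fin n) (Fin n) ℝ :=
  Matrix.diagonal fun i =>
    1 - (if Y i then gfun (dotProduct (X i) β) else gfun (-(dotProduct (X i) β)))


lemma aux_nphi_pos (x : ℝ) : 0 < nphi x := by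
  unfold nphi; positivity

lemma aux_nphi_cont : Continuous nphi := by
  unfold nphi; fun_prop

lemma aux_int (k : ℕ) : Integrable (fun t : ℝ => t ^ k * nphi t) := by
  have h := integrable_rpow_mul_exp_neg_mul_sq (b := 1 / 2) (by norm_num) (s := (k : ℝ))
    (by have : (0 : ℝ) ≤ k := Nat.cast_nonneg k
        linarith)
  have h2 := h.const_mul ((Real.sqrt (2 * Real.pi))⁻¹)
  refine h2.congr (Eventually.of_forall fun t => ?_)
  simp only [Real.rpow_natCast, nphi]
  have : -(1 / 2 : ℝ) * t ^ 2 = -(t ^ 2) / 2 := by ring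
  rw [this]; ring

lemma aux_deriv (x : ℝ) : HasDerivAt nphi (-x * nphi x) x := by
  unfold nphi
  have h1 : HasDerivAt (fun x : ℝ => -(x ^ 2) / 2) (-x) x := by
    have := ((hasDerivAt_pow 2 x).neg).div_const 2
    exact this.congr_deriv (by norm_num; ring)
  have := (h1.exp).const_mul ((Real.sqrt (2 * Real.pi))⁻¹)
  exact this.congr_deriv (by ring)

lemma aux_tendsto (k : ℕ) : Tendsto (fun t : ℝ => t ^ k * nphi t) atBot (nhds 0) := by
  have hd : ∀ x : ℝ, HasDerivAt (fun t : ℝ => t ^ k * nphi t)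
      (k * x ^ (k - 1) * nphi x + x ^ k * (-x * nphi x)) x := fun x =>
    (hasDerivAt_pow k x).mul (aux_deriv x)
  have hi : Integrable (fun x : ℝ => k * x ^ (k - 1) * nphi x + x ^ k * (-x * nphi x)) := by
    have := ((aux_int (k - 1)).const_mul (k : ℝ)).sub (aux_int (k + 1))
    refine this.congr (Eventually.of_forall fun t => ?_)
    simp only [Pi.sub_apply]
    ring
  exact tendsto_zero_of_hasDerivAt_of_integrableOn_Iic (a := 0) (fun x _ => hd x)
    hi.integrableOn (aux_int k).integrableOn

lemma aux_I1 (x : ℝ) : ∫ t in Set.Iic x, t ^ 1 * nphi t = - nphi x := by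
  have h0 := aux_tendsto 0
  simp only [pow_zero, one_mul] at h0
  have := integral_Iic_of_hasDerivAt_of_tendsto' (a := x) (f := fun t => - nphi t)
    (f' := fun t => t ^ 1 * nphi t) (m := 0)
    (fun t _ => by
      exact (aux_deriv t).neg.congr_deriv (by ring)) (aux_int 1).integrableOn (by simpa using h0.neg)
  rw [this]; ring

lemma aux_I2 (x : ℝ) : ∫ t in Set.Iic x, t ^ 2 * nphi t = nPhi x - x * nphi x := by
  have h0 := aux_tendsto 1
  have i0 := aux_int 0
  simp only [pow_zero, one_mul] at i0
  have := integral_Iic_of_hasDerivAt_of_tendsto' (a := x) (f := fun t => - (t ^ 1 * nphi t))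
    (f' := fun t => t ^ 2 * nphi t - nphi t) (m := 0)
    (fun t _ => by
      exact ((hasDerivAt_pow 1 t).mul (aux_deriv t)).neg.congr_deriv (by norm_num; ring)) ((aux_int 2).sub i0).integrableOn (by simpa using h0.neg)
  rw [integral_sub (aux_int 2).integrableOn i0.integrableOn] at this
  unfold nPhi
  linarith

lemma aux_I3 (x : ℝ) : ∫ t in Set.Iic x, t ^ 3 * nphi t = - (x ^ 2 * nphi x) - 2 * nphi x := by
  have h0 := aux_tendsto 2
  have i0 := aux_int 1
  have := integral_Iic_of_hasDerivAt_of_tendsto' (a := x) (f := fun t => - (t ^ 2 * nphi t))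
    (f' := fun t => t ^ 3 * nphi t - 2 * (t ^ 1 * nphi t)) (m := 0)
    (fun t _ => by
      exact ((hasDerivAt_pow 2 t).mul (aux_deriv t)).neg.congr_deriv (by norm_num; ring)) ((aux_int 3).sub (i0.const_mul 2)).integrableOn (by simpa using h0.neg)
  rw [integral_sub (aux_int 3).integrableOn (i0.const_mul 2).integrableOn,
    integral_const_mul, aux_I1] at this
  linarith

/-- general cubic moment -/
lemma aux_poly (x a b c d : ℝ) :
    ∫ t in Set.Iic x, (a + b * t + c * t ^ 2 + d * t ^ 3) * nphi t =
      a * nPhi x + b * (- nphi x) + c * (nPhi x - x * nphi x)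
        + d * (- (x ^ 2 * nphi x) - 2 * nphi x) := by
  have e : ∀ t : ℝ, (a + b * t + c * t ^ 2 + d * t ^ 3) * nphi t =
      a * (t ^ 0 * nphi t) + b * (t ^ 1 * nphi t) + c * (t ^ 2 * nphi t)
        + d * (t ^ 3 * nphi t) := fun t => by ring
  simp_rw [e]
  have j := fun k (r : ℝ) => ((aux_int k).const_mul r).integrableOn (s := Set.Iic x)
  have j1 : IntegrableOn (fun t => a * (t ^ 0 * nphi t) + b * (t ^ 1 * nphi t)) (Set.Iic x) :=
    (j 0 a).add (j 1 b)
  have j2 : IntegrableOn (fun t => a * (t ^ 0 * nphi t) + b * (t ^ 1 * nphi t)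
      + c * (t ^ 2 * nphi t)) (Set.Iic x) := j1.add (j 2 c)
  rw [integral_add j2 (j 3 d), integral_add j1 (j 2 c), integral_add (j 0 a) (j 1 b)]
  simp only [integral_const_mul, aux_I1, aux_I2, aux_I3]
  simp [nPhi]

lemma aux_pos (x : ℝ) (f : ℝ → ℝ) (hf : Continuous f) (hi : IntegrableOn f (Set.Iic x))
    (h : ∀ t < x, 0 < f t) : 0 < ∫ t in Set.Iic x, f t := by
  rw [integral_Iic_eq_integral_Iio]
  have hi' := hi.mono_set Set.Iio_subset_Iic_self
  rw [setIntegral_pos_iff_support_of_nonneg_ae]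
  · have : Function.support f ∩ Set.Iio x = Set.Iio x := by
      ext t
      simp only [Set.mem_inter_iff, Function.mem_support, Set.mem_Iio, and_iff_right_iff_imp]
      exact fun ht => (h t ht).ne'
    rw [this]
    simp
  · filter_upwards [ae_restrict_mem measurableSet_Iio] with t ht
    exact (h t ht).le
  · exact hi'

lemma aux_nPhi_pos (x : ℝ) : 0 < nPhi x := by
  have i0 := aux_int 0
  simp only [pow_zero, one_mul] at i0
  exact aux_pos x nphi aux_nphi_cont i0.integrableOn fun t _ => aux_nphi_pos t

/-- Mills: first moment positive -/
lemma aux_m1 (x : ℝ) : 0 < nphi x + x * nPhi x := by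
  have h := aux_poly x x (-1) 0 0
  have hp : 0 < ∫ t in Set.Iic x, (x + (-1) * t + 0 * t ^ 2 + 0 * t ^ 3) * nphi t := by
    apply aux_pos
    · have := aux_nphi_cont
      fun_prop
    · have := ((aux_int 0).const_mul x).sub (aux_int 1)
      refine (this.congr (Eventually.of_forall fun t => ?_)).integrableOn
      simp only [Pi.sub_apply]
      ring
    · intro t ht
      apply mul_pos _ (aux_nphi_pos t)
      linarith
  rw [h] at hp
  linarith

lemma aux_m3 (x : ℝ) : 0 ≤ x ^ 3 * nPhi x + 3 * x ^ 2 * nphi x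
    + 3 * x * (nPhi x - x * nphi x) + x ^ 2 * nphi x + 2 * nphi x := by
  have h := aux_poly x (x ^ 3) (-3 * x ^ 2) (3 * x) (-1)
  have hp : 0 ≤ ∫ t in Set.Iic x,
      (x ^ 3 + (-3 * x ^ 2) * t + (3 * x) * t ^ 2 + (-1) * t ^ 3) * nphi t := by
    apply setIntegral_nonneg measurableSet_Iic
    intro t ht
    have e : x ^ 3 + (-3 * x ^ 2) * t + (3 * x) * t ^ 2 + (-1) * t ^ 3 = (x - t) ^ 3 := by ring
    rw [e]
    have : 0 ≤ x - t := sub_nonneg.mpr ht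
    exact mul_nonneg (pow_nonneg this 3) (aux_nphi_pos t).le
  rw [h] at hp
  linarith

lemma aux_gfun_pos (x : ℝ) : 0 < gfun x := by
  have h1 := aux_m1 x
  have h2 := aux_nPhi_pos x
  have h3 := aux_nphi_pos x
  have e : gfun x = nphi x * (nphi x + x * nPhi x) / nPhi x ^ 2 := by
    unfold gfun; field_simp; ring
  rw [e]; positivity

lemma aux_gfun_le (x : ℝ) : gfun x ≤ 1 := by
  have h2 := aux_nPhi_pos x
  set r := nphi x / nPhi x with hr
  have e : nphi x = r * nPhi x := by rw [hr]; field_simp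
  have h := aux_poly x (r ^ 2) (2 * r) 1 0
  have hp : 0 ≤ ∫ t in Set.Iic x, (r ^ 2 + (2 * r) * t + 1 * t ^ 2 + 0 * t ^ 3) * nphi t := by
    apply setIntegral_nonneg measurableSet_Iic
    intro t _
    have e : r ^ 2 + (2 * r) * t + 1 * t ^ 2 + 0 * t ^ 3 = (r + t) ^ 2 := by ring
    rw [e]
    exact mul_nonneg (sq_nonneg _) (aux_nphi_pos t).le
  rw [h] at hp
  have e2 : gfun x = x * r + r ^ 2 := by unfold gfun; rw [hr]; ring
  rw [e2]
  rw [e] at hp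
  have : 0 ≤ nPhi x * (1 - (x * r + r ^ 2)) := by linarith
  have := nonneg_of_mul_nonneg_right this h2
  linarith

lemma aux_gfun_low (x : ℝ) (hx : x ≤ -1) : 1 / 3 ≤ gfun x := by
  have h1 := aux_m1 x
  have h2 := aux_nPhi_pos x
  have h3 := aux_m3 x
  set r := nphi x / nPhi x with hr
  have e : nphi x = r * nPhi x := by rw [hr]; field_simp
  have e2 : gfun x = x * r + r ^ 2 := by unfold gfun; rw [hr]; ring
  rw [e2]
  rw [e] at h1 h3
  have h1' : 0 < nPhi x * (r + x) := by linarith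
  have h1'' : 0 < r + x := pos_of_mul_pos_right h1' h2.le
  have h3' : 0 ≤ nPhi x * (x ^ 3 + 3 * x + (x ^ 2 + 2) * r) := by linarith
  have h3'' := nonneg_of_mul_nonneg_right h3' h2
  have h4 : -x ≤ (x ^ 2 + 2) * (r + x) := by linarith
  have h5 : (x ^ 2 + 2) ≤ 3 * x ^ 2 := by nlinarith
  have h6 : -x ≤ 3 * x ^ 2 * (r + x) := h4.trans (mul_le_mul_of_nonneg_right h5 h1''.le)
  have h7 : 1 ≤ 3 * (-x) * (r + x) := by
    by_contra hc
    push Not at hc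
    nlinarith
  nlinarith

lemma aux_nPhi_cont : Continuous nPhi := by
  have i0 := aux_int 0
  simp only [pow_zero, one_mul] at i0
  have e : nPhi = fun x => nPhi 0 + ∫ t in (0 : ℝ)..x, nphi t := by
    funext x
    have := intervalIntegral.integral_Iic_sub_Iic (a := 0) (b := x) (μ := volume) (f := nphi)
      i0.integrableOn i0.integrableOn
    unfold nPhi
    linarith
  rw [e]
  exact continuous_const.add (intervalIntegral.continuous_primitive
    (fun a b => aux_nphi_cont.intervalIntegrable a b) 0)

lemma aux_gfun_cont : Continuous gfun := by
  unfold gfun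
  have h1 := aux_nphi_cont
  have h2 := aux_nPhi_cont
  have h3 : ∀ x, nPhi x ≠ 0 := fun x => (aux_nPhi_pos x).ne'
  fun_prop (disch := assumption)

lemma aux_gfun_unif (M : ℝ) : ∃ ε > 0, ∀ u ≤ M, ε ≤ gfun u := by
  rcases (Set.Icc (-1) M).eq_empty_or_nonempty with h | h
  · refine ⟨1 / 3, by norm_num, fun u hu => aux_gfun_low u ?_⟩
    by_contra hc
    push Not at hc
    have : u ∈ Set.Icc (-1) M := ⟨hc.le, hu⟩
    rw [h] at this
    exact this
  · obtain ⟨z, _, hz⟩ := isCompact_Icc.exists_isMinOn h aux_gfun_cont.continuousOn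
    refine ⟨min (1 / 3) (gfun z), lt_min (by norm_num) (aux_gfun_pos z), fun u hu => ?_⟩
    rcases le_total u (-1) with h1 | h1
    · exact (min_le_left _ _).trans (aux_gfun_low u h1)
    · exact (min_le_right _ _).trans (hz ⟨h1, hu⟩)

lemma aux_compact {p : ℕ} (f h : (Fin p → ℝ) → ℝ) (hf : Continuous f) (hh : Continuous h)
    (hf2 : ∀ (s : ℝ) α, 0 ≤ s → f (s • α) = s ^ 2 * f α) (hh2 : ∀ (s : ℝ) α, h (s • α) = s ^ 2 * h α)
    (hpos : ∀ α, α ≠ 0 → 0 < f α) :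
    ∃ c > 0, ∀ α, α ≠ 0 → c * h α ≤ f α := by
  have hcpt := isCompact_sphere (0 : Fin p → ℝ) 1
  rcases (Metric.sphere (0 : Fin p → ℝ) 1).eq_empty_or_nonempty with he | hne
  · refine ⟨1, one_pos, fun α hα => ?_⟩
    exfalso
    have : ‖α‖⁻¹ • α ∈ Metric.sphere (0 : Fin p → ℝ) 1 := by
      simp [norm_smul, norm_ne_zero_iff.mpr hα]
    rw [he] at this
    exact this
  · obtain ⟨z, hzs, hz⟩ := hcpt.exists_isMinOn hne hf.continuousOn
    obtain ⟨w, _, hw⟩ := hcpt.exists_isMaxOn hne hh.continuousOn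
    have hz0 : z ≠ 0 := by
      rintro rfl
      simp at hzs
    have hfz := hpos z hz0
    have hK : 0 < |h w| + 1 := by positivity
    refine ⟨f z / (|h w| + 1), by positivity, fun α hα => ?_⟩
    have hn : ‖α‖ ≠ 0 := norm_ne_zero_iff.mpr hα
    set u := ‖α‖⁻¹ • α with hu
    have hus : u ∈ Metric.sphere (0 : Fin p → ℝ) 1 := by
      simp [hu, norm_smul, hn]
    have e : α = ‖α‖ • u := by rw [hu, smul_smul, mul_inv_cancel₀ hn, one_smul]
    have h1 : f z ≤ f u := hz hus
    have h2 : h u ≤ h w := hw hus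
    have h3 : f z / (|h w| + 1) * h u ≤ f u := by
      refine le_trans ?_ h1
      rw [div_mul_eq_mul_div, div_le_iff₀ hK]
      have := le_abs_self (h w)
      exact mul_le_mul_of_nonneg_left (by linarith) hfz.le
    rw [e, hf2 _ _ (norm_nonneg α), hh2]
    have := mul_le_mul_of_nonneg_left h3 (sq_nonneg ‖α‖)
    linarith

lemma aux_normSq_nonneg {m : ℕ} (x : Fin m → ℝ) : 0 ≤ normSq x :=
  Finset.sum_nonneg fun i _ => sq_nonneg _

lemma aux_normSq_dot {m : ℕ} (x : Fin m → ℝ) : normSq x = x ⬝ᵥ x := by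
  simp [normSq, dotProduct, sq]

lemma aux_sym_dot {p : ℕ} (T : Matrix (Fin p) (Fin p) ℝ) (hT : T.PosSemidef) (x : Fin p → ℝ) :
    normSq (T *ᵥ x) = x ⬝ᵥ ((T * T) *ᵥ x) := by
  have ht : Tᵀ = T := by
    have := hT.isHermitian
    rwa [IsHermitian, conjTranspose_eq_transpose_of_trivial] at this
  rw [aux_normSq_dot, ← mulVec_mulVec, dotProduct_mulVec x T, ← mulVec_transpose, ht]

lemma aux_Sig_dot {n p : ℕ} (X : Matrix (Fin n) (Fin p) ℝ) (Q : Matrix (Fin p) (Fin p) ℝ)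
    (x : Fin p → ℝ) :
    x ⬝ᵥ ((Xᵀ * X + Q) *ᵥ x) = normSq (X *ᵥ x) + x ⬝ᵥ (Q *ᵥ x) := by
  rw [add_mulVec, dotProduct_add, ← mulVec_mulVec, dotProduct_mulVec x Xᵀ, vecMul_transpose,
    aux_normSq_dot]

lemma aux_contr {n p : ℕ} (X : Matrix (Fin n) (Fin p) ℝ) (Q : Matrix (Fin p) (Fin p) ℝ)
    (hQ : Q.PosSemidef) (hSig : IsUnit (Xᵀ * X + Q).det)
    (T : Matrix (Fin p) (Fin p) ℝ) (hT : T.PosSemidef) (hTT : T * T = (Xᵀ * X + Q)⁻¹)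
    (w : Fin n → ℝ) : normSq (T *ᵥ (Xᵀ *ᵥ w)) ≤ normSq w := by
  set u := (Xᵀ * X + Q)⁻¹ *ᵥ (Xᵀ *ᵥ w) with hu
  have h1 : normSq (T *ᵥ (Xᵀ *ᵥ w)) = w ⬝ᵥ (X *ᵥ u) := by
    rw [aux_sym_dot T hT, hTT, ← hu, dotProduct_mulVec w X, mulVec_transpose]
  have h2 : (Xᵀ * X + Q) *ᵥ u = Xᵀ *ᵥ w := by
    rw [hu, mulVec_mulVec, mul_nonsing_inv _ hSig, one_mulVec]
  have h3 := aux_Sig_dot X Q u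
  rw [h2, dotProduct_comm, mulVec_transpose, ← dotProduct_mulVec] at h3
  have h4 : 0 ≤ u ⬝ᵥ (Q *ᵥ u) := by simpa using hQ.dotProduct_mulVec_nonneg u
  have h5 := aux_normSq_nonneg (w - X *ᵥ u)
  rw [aux_normSq_dot, sub_dotProduct, dotProduct_sub, dotProduct_sub,
    dotProduct_comm (X *ᵥ u) w, ← aux_normSq_dot, ← aux_normSq_dot] at h5
  linarith

/-- the drift coefficient λ is strictly less than 1, both when Q is
positive definite and when Q = 0, X has full column rank, and the condition
guaranteeing the existence of the posterior mode holds.  Here `S` is Σ^{1/2}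
and `T` is Σ^{-1/2}. -/
theorem drift_coefficient_lt_one
    (n p : ℕ) (hn : 1 ≤ n) (hp : 1 ≤ p)
    (X : Matrix (Fin n) (Fin p) ℝ) (Y : Fin n → Bool)
    (v : Fin p → ℝ) (Q : Matrix (Fin p) (Fin p) ℝ) (hQ : Q.PosSemidef)
    (hSig : IsUnit (Xᵀ * X + Q).det)
    (Bhat : Fin p → ℝ) (hmode : IsPosteriorMode X Y v Q Bhat)
    (S : Matrix (Fin p) (Fin p) ℝ) (hS : S.PosSemidef) (hSS : S * S = Xᵀ * X + Q)
    (T : Matrix (Fin p) (Fin p) ℝ) (hT : T.PosSemidef) (hTT : T * T = (Xᵀ * X + Q)⁻¹)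
    (lam : ℝ)
    (hlamdef : lam = sSup {r : ℝ | ∃ t ∈ Set.Ioo (0 : ℝ) 1, ∃ α : Fin p → ℝ, α ≠ 0 ∧
      r = normSq ((T * Xᵀ * Dmat X Y (Bhat + t • α) * X).mulVec α) / normSq (S.mulVec α)})
    (hcase :
      Q.PosDef ∨
      (Q = 0 ∧ X.rank = p ∧
        ∀ β : Fin p → ℝ, β ≠ 0 → ∃ i : Fin n,
          (if Y i then dotProduct (X i) β else 0) < 0 ∨
          0 < (if Y i then 0 else dotProduct (X i) β))) :
    lam < 1 := by
  have hSn : ∀ α, normSq (S *ᵥ α) = normSq (X *ᵥ α) + α ⬝ᵥ (Q *ᵥ α) := fun α => by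
    rw [aux_sym_dot S hS, hSS, aux_Sig_dot]
  have hhom : ∀ (s : ℝ) α, normSq (S *ᵥ (s • α)) = s ^ 2 * normSq (S *ᵥ α) := fun s α => by
    rw [mulVec_smul]
    simp [normSq, Finset.mul_sum, mul_pow]
  have hcont : Continuous fun α => normSq (S *ᵥ α) := by
    unfold normSq
    fun_prop
  suffices hmain : ∃ κ < 1, ∀ t ∈ Set.Ioo (0 : ℝ) 1, ∀ α : Fin p → ℝ, α ≠ 0 →
      normSq (Dmat X Y (Bhat + t • α) *ᵥ (X *ᵥ α)) ≤ κ * normSq (S *ᵥ α) by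
    obtain ⟨κ, hκ, hk⟩ := hmain
    have : lam ≤ max κ 0 := by
      rw [hlamdef]
      apply Real.sSup_le _ (le_max_right _ _)
      rintro r ⟨t, ht, α, hα, rfl⟩
      apply div_le_of_le_mul₀ (aux_normSq_nonneg _) (le_max_right _ _)
      have h1 := aux_contr X Q hQ hSig T hT hTT (Dmat X Y (Bhat + t • α) *ᵥ (X *ᵥ α))
      have e : (T * Xᵀ * Dmat X Y (Bhat + t • α) * X) *ᵥ α
          = T *ᵥ (Xᵀ *ᵥ (Dmat X Y (Bhat + t • α) *ᵥ (X *ᵥ α))) := by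
        simp only [mulVec_mulVec, Matrix.mul_assoc]
      rw [e]
      exact (h1.trans (hk t ht α hα)).trans
        (mul_le_mul_of_nonneg_right (le_max_left _ _) (aux_normSq_nonneg _))
    exact this.trans_lt (max_lt hκ one_pos)
  have hD : ∀ β α, normSq (Dmat X Y β *ᵥ (X *ᵥ α)) = ∑ i,
      (1 - (if Y i then gfun (X i ⬝ᵥ β) else gfun (-(X i ⬝ᵥ β)))) ^ 2 * (X i ⬝ᵥ α) ^ 2 := by
    intro β α
    simp only [normSq, Dmat, mulVec_diagonal, mul_pow]
    rfl
  have hXn : ∀ α, normSq (X *ᵥ α) = ∑ i, (X i ⬝ᵥ α) ^ 2 := fun α => rfl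
  rcases hcase with hpd | ⟨hQ0, -, hsep⟩
  · obtain ⟨c, hc, hle⟩ := aux_compact (fun α => α ⬝ᵥ (Q *ᵥ α)) (fun α => normSq (S *ᵥ α))
      (by fun_prop) hcont
      (fun s α _ => by
        simp only [mulVec_smul, smul_dotProduct, dotProduct_smul, smul_eq_mul]
        ring) hhom
      (fun α hα => by simpa using hpd.dotProduct_mulVec_pos hα)
    refine ⟨1 - c, by linarith, fun t _ α hα => ?_⟩
    have h1 := hle α hα
    have h2 := hSn α
    have h3 : normSq (Dmat X Y (Bhat + t • α) *ᵥ (X *ᵥ α)) ≤ normSq (X *ᵥ α) := by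
      rw [hD, hXn]
      apply Finset.sum_le_sum
      intro i _
      have : ∀ u, (1 - gfun u) ^ 2 ≤ 1 := fun u => by
        have := aux_gfun_pos u
        have := aux_gfun_le u
        nlinarith
      have h4 := sq_nonneg (X i ⬝ᵥ α)
      split_ifs <;> exact mul_le_of_le_one_left h4 (this _)
    linarith
  · set s : Fin n → ℝ := fun i => if Y i then 1 else -1 with hs
    obtain ⟨M, hM⟩ : ∃ M : ℝ, ∀ i, s i * (X i ⬝ᵥ Bhat) ≤ M := by
      obtain ⟨M, hM⟩ := (Set.finite_range fun i => s i * (X i ⬝ᵥ Bhat)).bddAbove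
      exact ⟨M, fun i => hM ⟨i, rfl⟩⟩
    obtain ⟨ε, hε, hge⟩ := aux_gfun_unif M
    obtain ⟨c, hc, hle⟩ := aux_compact (fun α => ∑ i, (min (s i * (X i ⬝ᵥ α)) 0) ^ 2)
      (fun α => normSq (S *ᵥ α)) (by fun_prop) hcont
      (fun r α hr => by
        simp only [dotProduct_smul, smul_eq_mul, Finset.mul_sum]
        refine Finset.sum_congr rfl fun i _ => ?_
        have : min (s i * (r * (X i ⬝ᵥ α))) 0 = r * min (s i * (X i ⬝ᵥ α)) 0 := by
          rw [mul_min_of_nonneg _ _ hr, mul_zero]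
          congr 1
          ring
        rw [this, mul_pow]) hhom
      (fun α hα => by
        obtain ⟨i, hi⟩ := hsep α hα
        have hneg : s i * (X i ⬝ᵥ α) < 0 := by
          simp only [hs]
          by_cases hy : Y i = true
          · simpa [hy] using hi
          · simpa [hy] using hi
        refine Finset.sum_pos' (fun j _ => sq_nonneg _) ⟨i, Finset.mem_univ i, ?_⟩
        rw [min_eq_left hneg.le]
        exact sq_pos_of_neg hneg)
    refine ⟨1 - ε * c, by nlinarith [mul_pos hε hc], fun t ht α hα => ?_⟩
    have h1 := hle α hα
    have h2 := hSn α
    have h3 : normSq (Dmat X Y (Bhat + t • α) *ᵥ (X *ᵥ α)) ≤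
        normSq (X *ᵥ α) - ε * ∑ i, (min (s i * (X i ⬝ᵥ α)) 0) ^ 2 := by
      rw [hD, hXn, Finset.mul_sum, ← Finset.sum_sub_distrib]
      apply Finset.sum_le_sum
      intro i _
      have eg : (if Y i then gfun (X i ⬝ᵥ (Bhat + t • α)) else gfun (-(X i ⬝ᵥ (Bhat + t • α))))
          = gfun (s i * (X i ⬝ᵥ Bhat) + t * (s i * (X i ⬝ᵥ α))) := by
        simp only [hs, dotProduct_add, dotProduct_smul, smul_eq_mul]
        split_ifs
        · congr 1; ring
        · congr 1; ring
      rw [eg]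
      have es : (s i) ^ 2 = 1 := by
        simp only [hs]
        split_ifs <;> norm_num
      have ex : (X i ⬝ᵥ α) ^ 2 = (s i * (X i ⬝ᵥ α)) ^ 2 := by rw [mul_pow, es, one_mul]
      rw [ex]
      set a := s i * (X i ⬝ᵥ α)
      have g0 := aux_gfun_pos (s i * (X i ⬝ᵥ Bhat) + t * a)
      have g1 := aux_gfun_le (s i * (X i ⬝ᵥ Bhat) + t * a)
      have ha := sq_nonneg a
      rcases le_total a 0 with h | h
      · have g2 := hge (s i * (X i ⬝ᵥ Bhat) + t * a) (by
          have := hM i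
          have := mul_nonpos_of_nonneg_of_nonpos ht.1.le h
          linarith)
        rw [min_eq_left h]
        have g3 : (1 - gfun (s i * (X i ⬝ᵥ Bhat) + t * a)) ^ 2 ≤ 1 - ε := by nlinarith
        have := mul_le_mul_of_nonneg_right g3 ha
        linarith
      · rw [min_eq_right h]
        have g3 : (1 - gfun (s i * (X i ⬝ᵥ Bhat) + t * a)) ^ 2 ≤ 1 := by nlinarith
        have := mul_le_mul_of_nonneg_right g3 ha
        linarith
    have h4 : α ⬝ᵥ (Q *ᵥ α) = 0 := by rw [hQ0]; simp
    have h5 := mul_le_mul_of_nonneg_left h1 hε.le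
    have h6 : (1 - ε * c) * normSq (S *ᵥ α)
      = normSq (S *ᵥ α) - ε * (c * normSq (S *ᵥ α)) := by ring
    linarith
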